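/- Let ρ > 1. Then, as n → ∞, the functions ζ ↦ E_{1/ρ}(R_n (1 + (2/(ρn))^{1/2} ζ)) / ((1 + (2/(ρn))^{1/2} ζ)^n E_{1/ρ}(R_n)) converge to the function ζ ↦ e^{ζ²}, uniformly on every compact subset of the complex ζ-plane. -/

import Mathlib

open Complex Real Filter Topology

/-- `R_n = Γ(1+n/ρ)/Γ(1+(n-1)/ρ)`. -/
noncomputable def Rn (ρ : ℝ) (n : ℕ) : ℝ :=
  Real.Gamma (1 + (n : ℝ) / ρ) / Real.Gamma (1 + ((n : ℝ) - 1) / ρ)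

/-- The Mittag–Leffler function `E_{1/ρ}(z) = Σ_{j=0}^∞ z^j/Γ(1+j/ρ)`. -/
noncomputable def mlE (ρ : ℝ) (z : ℂ) : ℂ :=
  ∑' j : ℕ, z ^ j / (Real.Gamma (1 + (j : ℝ) / ρ) : ℂ)

/-- `log Γ(1+x/ρ)`. -/
noncomputable def logGammaScaled (ρ x : ℝ) : ℝ := Real.log (Real.Gamma (1 + x / ρ))

/-- The logarithm of the ratio of the terms of index `x` and `n` in the series for
`E_{1/ρ}(R_n)`. -/
noncomputable def logTerm (ρ : ℝ) (n : ℕ) (x : ℝ) : ℝ :=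
  (x - n) * Real.log (Rn ρ n) + logGammaScaled ρ n - logGammaScaled ρ x

lemma one_add_div_pos {ρ x : ℝ} (hρ : 1 < ρ) (hx : -1 ≤ x) : 0 < 1 + x / ρ := by
  have h0 : 0 < ρ := by linarith
  have : 1 + x / ρ = (ρ + x) / ρ := by field_simp
  rw [this]
  exact div_pos (by linarith) h0

lemma convexOn_logGammaScaled {ρ : ℝ} (hρ : 1 < ρ) :
    ConvexOn ℝ (Set.Ici (-1)) (logGammaScaled ρ) := by
  refine ⟨convex_Ici _, fun x hx y hy a b ha hb hab => ?_⟩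
  have h := Real.convexOn_log_Gamma.2 (one_add_div_pos hρ hx) (one_add_div_pos hρ hy) ha hb hab
  simp only [smul_eq_mul, Function.comp_apply] at h
  simp only [smul_eq_mul, logGammaScaled]
  have e : 1 + (a * x + b * y) / ρ = a * (1 + x / ρ) + b * (1 + y / ρ) := by
    linear_combination -hab
  rw [e]
  exact h

lemma Rn_pos {ρ : ℝ} (hρ : 1 < ρ) (n : ℕ) : 0 < Rn ρ n := by
  have hn : (0 : ℝ) ≤ n := n.cast_nonneg
  exact div_pos (Real.Gamma_pos_of_pos (one_add_div_pos hρ (by linarith)))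
    (Real.Gamma_pos_of_pos (one_add_div_pos hρ (by linarith)))

lemma log_Rn {ρ : ℝ} (hρ : 1 < ρ) (n : ℕ) :
    Real.log (Rn ρ n) = logGammaScaled ρ n - logGammaScaled ρ ((n : ℝ) - 1) := by
  have hn : (0 : ℝ) ≤ n := n.cast_nonneg
  exact Real.log_div (Real.Gamma_pos_of_pos (one_add_div_pos hρ (by linarith))).ne'
    (Real.Gamma_pos_of_pos (one_add_div_pos hρ (by linarith))).ne'

lemma logGammaScaled_add_self {ρ x : ℝ} (hρ : 1 < ρ) (hx : -1 ≤ x) :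
    logGammaScaled ρ (x + ρ) - logGammaScaled ρ x = Real.log (1 + x / ρ) := by
  have h0 := one_add_div_pos hρ hx
  have hρ0 : ρ ≠ 0 := by linarith
  unfold logGammaScaled
  rw [show 1 + (x + ρ) / ρ = (1 + x / ρ) + 1 by field_simp; ring, Real.Gamma_add_one h0.ne',
    Real.log_mul h0.ne' (Real.Gamma_pos_of_pos h0).ne']
  ring

lemma mul_log_Rn_le {ρ : ℝ} (hρ : 1 < ρ) (n : ℕ) :
    ρ * Real.log (Rn ρ n) ≤ Real.log (1 + ((n : ℝ) - 1) / ρ) := by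
  have hn : (0 : ℝ) ≤ n := n.cast_nonneg
  have h := (convexOn_logGammaScaled hρ).secant_mono (a := (n : ℝ) - 1) (x := n)
    (y := (n : ℝ) - 1 + ρ) (by simp) (by simp; linarith) (by simp; linarith)
    (by intro h; linarith) (by intro h; linarith) (by linarith)
  rw [logGammaScaled_add_self hρ (by linarith), ← log_Rn hρ] at h
  rw [show (n : ℝ) - (n - 1) = 1 by ring, show (n : ℝ) - 1 + ρ - (n - 1) = ρ by ring, div_one,
    le_div_iff₀ (by linarith)] at h
  linarith

lemma le_mul_log_Rn {ρ : ℝ} (hρ : 1 < ρ) {n : ℕ} (hn : ρ ≤ n) :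
    Real.log (((n : ℝ) - 1) / ρ) ≤ ρ * Real.log (Rn ρ n) := by
  have h := (convexOn_logGammaScaled hρ).slope_mono_adjacent (x := (n : ℝ) - 1 - ρ)
    (y := (n : ℝ) - 1) (z := n) (by simp; linarith) (by simp; linarith) (by linarith)
    (by linarith)
  have h2 := logGammaScaled_add_self (x := (n : ℝ) - 1 - ρ) hρ (by linarith)
  rw [sub_add_cancel] at h2
  have hρ0 : ρ ≠ 0 := by linarith
  rw [h2, ← log_Rn hρ, show (n : ℝ) - (n - 1) = 1 by ring,
    show (n : ℝ) - 1 - (n - 1 - ρ) = ρ by ring, div_one, div_le_iff₀ (by linarith)] at h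
  rw [show ((n : ℝ) - 1) / ρ = 1 + ((n : ℝ) - 1 - ρ) / ρ by field_simp; ring]
  linarith

lemma abs_mul_log_Rn_sub_le {ρ : ℝ} (hρ : 1 < ρ) {n : ℕ} (hn : ρ ≤ n) (hn2 : 2 ≤ n) :
    |ρ * Real.log (Rn ρ n) - (Real.log n - Real.log ρ)| ≤ (ρ + 2) / n := by
  have hn2' : (2 : ℝ) ≤ n := by exact_mod_cast hn2
  have h0 : 0 < ρ := by linarith
  have hn0 : (0 : ℝ) < n := by linarith
  have h1 := mul_log_Rn_le hρ n
  have h2 := le_mul_log_Rn hρ hn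
  rw [Real.log_div (by linarith) h0.ne'] at h2
  rw [show 1 + ((n : ℝ) - 1) / ρ = (n - 1 + ρ) / ρ by field_simp; ring,
    Real.log_div (by linarith) h0.ne'] at h1
  have h3 : Real.log ((n : ℝ) - 1 + ρ) - Real.log n ≤ (ρ - 1) / n := by
    rw [← Real.log_div (by linarith) hn0.ne']
    refine (Real.log_le_sub_one_of_pos (div_pos (by linarith) hn0)).trans_eq ?_
    field_simp
    ring
  have h4 : -(2 / (n : ℝ)) ≤ Real.log ((n : ℝ) - 1) - Real.log n := by
    rw [← Real.log_div (by linarith) hn0.ne']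
    refine le_trans ?_ (Real.one_sub_inv_le_log_of_pos (div_pos (by linarith) hn0))
    rw [inv_div, neg_le_sub_iff_le_add, add_div' _ _ _ hn0.ne', div_le_div_iff₀ (by linarith) hn0]
    nlinarith
  have h5 : (ρ - 1) / (n : ℝ) ≤ (ρ + 2) / n := by gcongr; linarith
  have h6 : 2 / (n : ℝ) ≤ (ρ + 2) / n := by gcongr; linarith
  rw [abs_le]
  constructor <;> linarith

lemma abs_log_one_add_sub_self_le {x : ℝ} (hx : |x| ≤ 1 / 2) :
    |Real.log (1 + x) - x| ≤ 2 * x ^ 2 := by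
  have h := abs_le.1 hx
  have h1 := Real.log_le_sub_one_of_pos (x := 1 + x) (by linarith)
  have h2 := Real.one_sub_inv_le_log_of_pos (x := 1 + x) (by linarith)
  have h3 : x - 2 * x ^ 2 ≤ 1 - (1 + x)⁻¹ := by
    have h5 : 1 - (1 + x)⁻¹ = x / (1 + x) := by
      have : 1 + x ≠ 0 := by linarith
      field_simp
      ring
    rw [h5, le_div_iff₀ (by linarith)]
    nlinarith [sq_nonneg x]
  rw [abs_le]
  constructor <;> nlinarith [sq_nonneg x]

lemma abs_log_Rn_sub_log_Rn_le {ρ : ℝ} (hρ : 1 < ρ) {n m : ℕ} (hn : 2 * ρ ≤ n) (hn4 : 4 ≤ n)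
    (hm : |(m : ℝ) - n| ≤ n / 2) :
    |ρ * (Real.log (Rn ρ m) - Real.log (Rn ρ n)) - ((m : ℝ) - n) / n| ≤
      3 * (ρ + 2) / n + 2 * (((m : ℝ) - n) / n) ^ 2 := by
  have hn4' : (4 : ℝ) ≤ n := by exact_mod_cast hn4
  have hn0 : (0 : ℝ) < n := by linarith
  have hm' := abs_le.1 hm
  have hm2 : 2 ≤ m := by
    have : (2 : ℝ) ≤ m := by linarith
    exact_mod_cast this
  have hm0 : (0 : ℝ) < m := by linarith
  have h1 := abs_mul_log_Rn_sub_le hρ (n := n) (by linarith) (by linarith)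
  have h2 := abs_mul_log_Rn_sub_le hρ (n := m) (by linarith) hm2
  have h3 : (ρ + 2) / (m : ℝ) ≤ 2 * (ρ + 2) / n := by
    rw [div_le_div_iff₀ hm0 hn0]
    nlinarith
  have h4 : |Real.log (1 + ((m : ℝ) - n) / n) - ((m : ℝ) - n) / n| ≤
      2 * (((m : ℝ) - n) / n) ^ 2 := by
    refine abs_log_one_add_sub_self_le ?_
    rw [abs_div, abs_of_pos hn0, div_le_iff₀ hn0]
    linarith
  rw [show 1 + ((m : ℝ) - n) / n = m / n by field_simp; ring,
    Real.log_div hm0.ne' hn0.ne'] at h4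
  have h5 : 3 * (ρ + 2) / (n : ℝ) = 2 * (ρ + 2) / n + (ρ + 2) / n := by ring
  rw [h5]
  rw [abs_le] at *
  constructor <;> linarith [h1.1, h1.2, h2.1, h2.2, h4.1, h4.2]

lemma logTerm_succ_sub {ρ : ℝ} (hρ : 1 < ρ) (n m : ℕ) :
    logTerm ρ n (m + 1 : ℕ) - logTerm ρ n m = Real.log (Rn ρ n) - Real.log (Rn ρ (m + 1)) := by
  rw [log_Rn hρ (m + 1)]
  unfold logTerm
  push_cast
  rw [add_sub_cancel_right]
  ring

lemma logTerm_self (ρ : ℝ) (n : ℕ) : logTerm ρ n n = 0 := by simp [logTerm]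

lemma logTerm_sub_one {ρ : ℝ} (hρ : 1 < ρ) (n : ℕ) : logTerm ρ n ((n : ℝ) - 1) = 0 := by
  rw [logTerm, log_Rn hρ]
  ring

lemma concaveOn_logTerm {ρ : ℝ} (hρ : 1 < ρ) (n : ℕ) :
    ConcaveOn ℝ (Set.Ici (-1)) (logTerm ρ n) := by
  refine ⟨convex_Ici _, fun x hx y hy a b ha hb hab => ?_⟩
  have h := (convexOn_logGammaScaled hρ).2 hx hy ha hb hab
  simp only [smul_eq_mul, logTerm] at h ⊢
  have e : a * ((x - n) * Real.log (Rn ρ n) + logGammaScaled ρ n - logGammaScaled ρ x) +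
      b * ((y - n) * Real.log (Rn ρ n) + logGammaScaled ρ n - logGammaScaled ρ y) =
      (a * x + b * y - n) * Real.log (Rn ρ n) + logGammaScaled ρ n -
        (a * logGammaScaled ρ x + b * logGammaScaled ρ y) := by
    linear_combination (-n * Real.log (Rn ρ n) + logGammaScaled ρ n) * hab
  linarith

lemma abs_logTerm_add_le {ρ T : ℝ} (hρ : 1 < ρ) {n : ℕ} (hn : 2 * ρ ≤ n) (hn4 : 4 ≤ n)
    (hT : T * √(n : ℝ) ≤ n / 2) {m : ℕ} (hm : |(m : ℝ) - n| ≤ T * √(n : ℝ)) :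
    |logTerm ρ n m + ((m : ℝ) - n) ^ 2 / (2 * ρ * n)| ≤
      (3 * (ρ + 2) + 2 * T ^ 2 + 1) / n * |(m : ℝ) - n| := by
  have hn0 : (0 : ℝ) < n := by linarith
  have hρ0 : 0 < ρ := by linarith
  set C := (3 * (ρ + 2) + 2 * T ^ 2 + 1) / (n : ℝ) with hC
  let f : ℕ → ℝ := fun k => logTerm ρ n k + ((k : ℝ) - n) ^ 2 / (2 * ρ * n)
  have hfn : f n = 0 := by simp [f, logTerm_self]
  have step (k : ℕ) (hk : |((k + 1 : ℕ) : ℝ) - n| ≤ T * √(n : ℝ)) :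
      dist (f k) (f (k + 1)) ≤ C := by
    have h := abs_log_Rn_sub_log_Rn_le hρ hn hn4 (hk.trans hT)
    have hs := logTerm_succ_sub hρ n k
    have hq : 2 * ((((k + 1 : ℕ) : ℝ) - n) / n) ^ 2 ≤ 2 * T ^ 2 / n := by
      have : (((k + 1 : ℕ) : ℝ) - n) ^ 2 ≤ T ^ 2 * n := by
        calc (((k + 1 : ℕ) : ℝ) - n) ^ 2 = |((k + 1 : ℕ) : ℝ) - n| ^ 2 := (sq_abs _).symm
          _ ≤ (T * √(n : ℝ)) ^ 2 := by gcongr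
          _ = T ^ 2 * n := by rw [mul_pow, Real.sq_sqrt hn0.le]
      rw [div_pow, mul_div_assoc', div_le_div_iff₀ (by positivity) hn0]
      nlinarith
    have hd : f (k + 1) - f k = -(1 / ρ) * ((ρ * (Real.log (Rn ρ (k + 1)) - Real.log (Rn ρ n)) -
        (((k + 1 : ℕ) : ℝ) - n) / n) + 1 / (2 * n)) := by
      have : f (k + 1) - f k = (logTerm ρ n (k + 1 : ℕ) - logTerm ρ n k) +
          (2 * ((k : ℝ) - n) + 1) / (2 * ρ * n) := by
        simp only [f]
        push_cast
        ring
      rw [this, hs]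
      push_cast
      field_simp
      ring
    rw [dist_comm, Real.dist_eq, hd, abs_mul, abs_neg, abs_of_pos (by positivity : 0 < 1 / ρ)]
    have h1 : 1 / ρ ≤ 1 := by
      rw [div_le_one hρ0]
      exact hρ.le
    have hhalf : (0 : ℝ) < 1 / (2 * n) := by positivity
    have hone : (1 : ℝ) / (2 * n) ≤ 1 / n := by
      gcongr
      linarith
    calc 1 / ρ * _ ≤ 1 * _ := by gcongr
      _ ≤ (3 * (ρ + 2) / n + 2 * T ^ 2 / n) + 1 / n := by
        rw [one_mul]
        refine (abs_add_le _ _).trans ?_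
        rw [abs_of_pos hhalf]
        exact add_le_add (h.trans (by linarith)) hone
      _ = C := by rw [hC]; ring
  change |f m| ≤ C * |(m : ℝ) - n|
  have hm' := abs_le.1 hm
  rcases le_total n m with hnm | hnm
  · have hnm' : (n : ℝ) ≤ m := by exact_mod_cast hnm
    have h := dist_le_Ico_sum_of_dist_le (f := f) hnm (d := fun _ => C) (fun {k} hk hkm => by
      refine step k ?_
      have a1 : (n : ℝ) ≤ k := by exact_mod_cast hk
      have a2 : ((k + 1 : ℕ) : ℝ) ≤ m := by exact_mod_cast hkm
      push_cast at *
      rw [abs_of_nonneg (by linarith)]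
      linarith)
    rw [hfn, dist_comm, dist_zero_right, Real.norm_eq_abs, Finset.sum_const, Nat.card_Ico,
      nsmul_eq_mul, Nat.cast_sub hnm] at h
    rwa [abs_of_nonneg (by linarith : (0 : ℝ) ≤ m - n), mul_comm]
  · have hnm' : (m : ℝ) ≤ n := by exact_mod_cast hnm
    have h := dist_le_Ico_sum_of_dist_le (f := f) hnm (d := fun _ => C) (fun {k} hk hkm => by
      refine step k ?_
      have a1 : (m : ℝ) ≤ k := by exact_mod_cast hk
      have a2 : ((k + 1 : ℕ) : ℝ) ≤ n := by exact_mod_cast hkm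
      push_cast at *
      rw [abs_of_nonpos (by linarith)]
      linarith)
    rw [hfn, dist_zero_right, Real.norm_eq_abs, Finset.sum_const, Nat.card_Ico,
      nsmul_eq_mul, Nat.cast_sub hnm] at h
    rw [abs_of_nonpos (by linarith : (m : ℝ) - n ≤ 0)]
    linarith

/-- The index at distance about `t √n` from `n`. -/
noncomputable def nearIndex (n : ℕ) (t : ℝ) : ℕ := ⌊(n : ℝ) + t * √(n : ℝ)⌋₊

lemma tendsto_sqrt_natCast_atTop : Tendsto (fun n : ℕ => √(n : ℝ)) atTop atTop :=
  Real.tendsto_sqrt_atTop.comp tendsto_natCast_atTop_atTop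

lemma eventually_natCast_add_mul_sqrt_nonneg (t : ℝ) :
    ∀ᶠ n : ℕ in atTop, 0 ≤ (n : ℝ) + t * √(n : ℝ) := by
  filter_upwards [tendsto_sqrt_natCast_atTop.eventually_ge_atTop (-t)] with n hn
  have h1 := Real.mul_self_sqrt (n.cast_nonneg : (0 : ℝ) ≤ n)
  nlinarith [Real.sqrt_nonneg (n : ℝ)]

lemma abs_nearIndex_sub_le {n : ℕ} {t : ℝ} (h : 0 ≤ (n : ℝ) + t * √(n : ℝ)) :
    |(nearIndex n t : ℝ) - n - t * √(n : ℝ)| ≤ 1 := by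
  have h1 := Nat.floor_le h
  have h2 := Nat.lt_floor_add_one ((n : ℝ) + t * √(n : ℝ))
  unfold nearIndex
  rw [abs_le]
  constructor <;> linarith

lemma tendsto_nearIndex (t : ℝ) :
    Tendsto (fun n : ℕ => ((nearIndex n t : ℝ) - n) / √(n : ℝ)) atTop (𝓝 t) := by
  rw [tendsto_iff_dist_tendsto_zero]
  refine squeeze_zero' (Eventually.of_forall fun _ => dist_nonneg) ?_
    (tendsto_inv_atTop_zero.comp tendsto_sqrt_natCast_atTop)
  filter_upwards [eventually_natCast_add_mul_sqrt_nonneg t,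
    tendsto_sqrt_natCast_atTop.eventually_gt_atTop 0] with n hn hn0
  rw [Real.dist_eq, div_sub' hn0.ne', abs_div, abs_of_pos hn0, Function.comp_apply, inv_eq_one_div]
  gcongr
  rw [mul_comm]
  exact abs_nearIndex_sub_le hn

lemma tendsto_logTerm_nearIndex {ρ : ℝ} (hρ : 1 < ρ) (t : ℝ) :
    Tendsto (fun n : ℕ => logTerm ρ n (nearIndex n t)) atTop (𝓝 (-t ^ 2 / (2 * ρ))) := by
  have hρ0 : 0 < ρ := by linarith
  have hmain : Tendsto (fun n : ℕ => -(((nearIndex n t : ℝ) - n) / √(n : ℝ)) ^ 2 / (2 * ρ)) atTop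
      (𝓝 (-t ^ 2 / (2 * ρ))) := ((tendsto_nearIndex t).pow 2).neg.div_const _
  set T := |t| + 1 with hT
  have hT0 : 0 < T := by positivity
  set C := (3 * (ρ + 2) + 2 * T ^ 2 + 1) * T with hC
  have herr : Tendsto (fun n : ℕ => C * (√(n : ℝ))⁻¹) atTop (𝓝 0) := by
    simpa using (tendsto_inv_atTop_zero.comp tendsto_sqrt_natCast_atTop).const_mul C
  refine tendsto_of_tendsto_of_dist hmain (squeeze_zero' (Eventually.of_forall fun _ =>
    dist_nonneg) ?_ herr)
  filter_upwards [eventually_natCast_add_mul_sqrt_nonneg t,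
    tendsto_sqrt_natCast_atTop.eventually_ge_atTop (2 * T), eventually_ge_atTop 4,
    tendsto_natCast_atTop_atTop.eventually_ge_atTop (2 * ρ)] with n hn hnT hn4 hnρ
  have hs0 : 0 < √(n : ℝ) := by linarith
  have hss := Real.mul_self_sqrt (n.cast_nonneg : (0 : ℝ) ≤ n)
  have hn0 : (0 : ℝ) < n := by rw [← hss]; positivity
  have hs1 : 1 ≤ √(n : ℝ) := by linarith [abs_nonneg t]
  have hd : |(nearIndex n t : ℝ) - n| ≤ T * √(n : ℝ) := by
    have h := abs_nearIndex_sub_le hn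
    calc |(nearIndex n t : ℝ) - n| = |((nearIndex n t : ℝ) - n - t * √(n : ℝ)) + t * √(n : ℝ)| := by
          ring_nf
      _ ≤ 1 + |t| * √(n : ℝ) := by
          refine (abs_add_le _ _).trans ?_
          rw [abs_mul, abs_of_pos hs0]
          linarith
      _ ≤ T * √(n : ℝ) := by rw [hT]; linarith
  have h := abs_logTerm_add_le hρ hnρ hn4 (by nlinarith) hd
  rw [Real.dist_eq, abs_sub_comm]
  have e : logTerm ρ n (nearIndex n t) - -(((nearIndex n t : ℝ) - n) / √(n : ℝ)) ^ 2 / (2 * ρ) =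
      logTerm ρ n (nearIndex n t) + ((nearIndex n t : ℝ) - n) ^ 2 / (2 * ρ * n) := by
    rw [div_pow, Real.sq_sqrt hn0.le]
    field_simp
    ring
  rw [e]
  calc _ ≤ _ := h
    _ ≤ (3 * (ρ + 2) + 2 * T ^ 2 + 1) / n * (T * √(n : ℝ)) := by gcongr
    _ = C * (√(n : ℝ))⁻¹ := by
      rw [hC]
      nth_rewrite 1 [← hss]
      field_simp

lemma logTerm_nonpos {ρ : ℝ} (hρ : 1 < ρ) (n m : ℕ) : logTerm ρ n m ≤ 0 := by
  have hn : (0 : ℝ) ≤ n := n.cast_nonneg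
  have hm : (0 : ℝ) ≤ m := m.cast_nonneg
  rcases lt_trichotomy n m with h | h | h
  · have h' : (n : ℝ) < m := by exact_mod_cast h
    have := (concaveOn_logTerm hρ n).slope_anti_adjacent (x := (n : ℝ) - 1) (y := n) (z := m)
      (by simp) (by simp; linarith) (by linarith) h'
    rw [logTerm_self, logTerm_sub_one hρ, sub_zero, sub_zero, zero_div,
      div_le_iff₀ (by linarith), zero_mul] at this
    exact this
  · subst h
    exact (logTerm_self ρ n).le
  · have h' : (m : ℝ) + 1 ≤ n := by exact_mod_cast h
    rcases h'.eq_or_lt with h1 | h1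
    · rw [show (m : ℝ) = n - 1 by linarith, logTerm_sub_one hρ]
    have := (concaveOn_logTerm hρ n).slope_anti_adjacent (x := (m : ℝ)) (y := (n : ℝ) - 1) (z := n)
      (by simp; linarith) (by simp; linarith) (by linarith) (by linarith)
    rw [logTerm_self, logTerm_sub_one hρ, sub_zero, zero_div, zero_sub,
      le_div_iff₀ (by linarith), zero_mul] at this
    linarith

lemma logTerm_le_mul_abs_sub {ρ a : ℝ} (hρ : 1 < ρ) {n p m : ℕ}
    (h : n < p ∧ p ≤ m ∨ m ≤ p ∧ p < n) (ha : logTerm ρ n p ≤ -a * |(p : ℝ) - n|) :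
    logTerm ρ n m ≤ -a * |(m : ℝ) - n| := by
  have hn : (0 : ℝ) ≤ n := n.cast_nonneg
  have hm : (0 : ℝ) ≤ m := m.cast_nonneg
  have hp : (0 : ℝ) ≤ p := p.cast_nonneg
  rcases h with ⟨h1, h2⟩ | ⟨h1, h2⟩
  · have h1' : (n : ℝ) < p := by exact_mod_cast h1
    have h2' : (p : ℝ) ≤ m := by exact_mod_cast h2
    have := (concaveOn_logTerm hρ n).neg.secant_mono (a := (n : ℝ)) (x := p) (y := m)
      (by simp; linarith) (by simp; linarith) (by simp; linarith) h1'.ne' (by linarith) h2'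
    simp only [Pi.neg_apply, logTerm_self, neg_zero, sub_zero] at this
    rw [abs_of_nonneg (by linarith)] at ha ⊢
    have h3 : a ≤ -logTerm ρ n p / (p - n) := by
      rw [le_div_iff₀ (by linarith)]
      linarith
    have h4 := h3.trans this
    rw [le_div_iff₀ (by linarith)] at h4
    linarith
  · have h1' : (m : ℝ) ≤ p := by exact_mod_cast h1
    have h2' : (p : ℝ) < n := by exact_mod_cast h2
    have := (concaveOn_logTerm hρ n).neg.secant_mono (a := (n : ℝ)) (x := m) (y := p)
      (by simp; linarith) (by simp; linarith) (by simp; linarith) (by linarith) h2'.ne h1'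
    simp only [Pi.neg_apply, logTerm_self, neg_zero, sub_zero] at this
    rw [abs_of_nonpos (by linarith)] at ha ⊢
    have h3 : -logTerm ρ n p / (p - n) ≤ -a := by
      rw [div_le_iff_of_neg (by linarith)]
      linarith
    have h4 := this.trans h3
    rw [div_le_iff_of_neg (by linarith)] at h4
    linarith

lemma eventually_logTerm_nearIndex_le {ρ c t : ℝ} (hρ : 1 < ρ) (hc : 2 * ρ * c < |t|)
    (ht : t ≠ 0) :
    ∀ᶠ n : ℕ in atTop, logTerm ρ n (nearIndex n t) ≤
      -(c / √(n : ℝ)) * |(nearIndex n t : ℝ) - n| := by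
  have h1 : Tendsto (fun n : ℕ => logTerm ρ n (nearIndex n t) +
      c * |((nearIndex n t : ℝ) - n) / √(n : ℝ)|) atTop
      (𝓝 (-t ^ 2 / (2 * ρ) + c * |t|)) :=
    (tendsto_logTerm_nearIndex hρ t).add ((tendsto_nearIndex t).abs.const_mul c)
  have hneg : -t ^ 2 / (2 * ρ) + c * |t| < 0 := by
    rw [← sq_abs, div_add' _ _ _ (by positivity), div_lt_iff₀ (by positivity)]
    nlinarith [abs_pos.2 ht]
  filter_upwards [h1.eventually_lt_const hneg] with n hn
  rw [abs_div, abs_of_nonneg (Real.sqrt_nonneg _)] at hn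
  have e : c * (|(nearIndex n t : ℝ) - n| / √(n : ℝ)) =
    (c / √(n : ℝ)) * |(nearIndex n t : ℝ) - n| := by ring
  linarith

lemma exists_logTerm_le {ρ c : ℝ} (hρ : 1 < ρ) (hc : 0 < c) :
    ∃ D : ℝ, ∀ᶠ n : ℕ in atTop, ∀ m : ℕ,
      logTerm ρ n m ≤ D - c * (|(m : ℝ) - n| / √(n : ℝ)) := by
  have hρ0 : 0 < ρ := by linarith
  set T := 2 * ρ * c + 1 with hT
  have hT0 : 0 < T := by positivity
  refine ⟨c * (T + 1), ?_⟩
  filter_upwards [eventually_logTerm_nearIndex_le (c := c) (t := T) hρ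
      (by rw [abs_of_pos hT0]; linarith) hT0.ne',
    eventually_logTerm_nearIndex_le (c := c) (t := -T) hρ
      (by rw [abs_neg, abs_of_pos hT0]; linarith) (neg_ne_zero.2 hT0.ne'),
    (tendsto_nearIndex T).eventually_lt_const (by linarith : T < T + 1),
    (tendsto_nearIndex T).eventually_const_lt hT0,
    (tendsto_nearIndex (-T)).eventually_const_lt (by linarith : -(T + 1) < -T),
    (tendsto_nearIndex (-T)).eventually_lt_const (neg_neg_of_pos hT0),
    tendsto_sqrt_natCast_atTop.eventually_gt_atTop 0] with n hp hq hpT hp0 hqT hq0 hn m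
  rw [div_lt_iff₀ hn] at hpT hq0
  rw [lt_div_iff₀ hn] at hp0 hqT
  have hnp : n < nearIndex n T := by
    have : (n : ℝ) < nearIndex n T := by linarith
    exact_mod_cast this
  have hqn : nearIndex n (-T) < n := by
    have : (nearIndex n (-T) : ℝ) < n := by linarith
    exact_mod_cast this
  have e (m : ℕ) : -(c / √(n : ℝ)) * |(m : ℝ) - n| = - (c * (|(m : ℝ) - n| / √(n : ℝ))) := by ring
  have hD : 0 < c * (T + 1) := by positivity
  by_cases h1 : nearIndex n T ≤ m
  · have := logTerm_le_mul_abs_sub hρ (Or.inl ⟨hnp, h1⟩) hp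
    rw [e] at this
    linarith
  by_cases h2 : m ≤ nearIndex n (-T)
  · have := logTerm_le_mul_abs_sub hρ (Or.inr ⟨h2, hqn⟩) hq
    rw [e] at this
    linarith
  push Not at h1 h2
  have h1' : (m : ℝ) < nearIndex n T := by exact_mod_cast h1
  have h2' : (nearIndex n (-T) : ℝ) < m := by exact_mod_cast h2
  have h3 : |(m : ℝ) - n| / √(n : ℝ) ≤ T + 1 := by
    rw [div_le_iff₀ hn, abs_le]
    constructor <;> linarith
  have := logTerm_nonpos hρ n m
  nlinarith

open MeasureTheory in
lemma integral_indicator_floor (h : ℕ → ℂ)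
    (hi : Integrable ((Set.Ici (0 : ℝ)).indicator fun u => h ⌊u⌋₊)) :
    ∫ u : ℝ, (Set.Ici (0 : ℝ)).indicator (fun u => h ⌊u⌋₊) u = ∑' j, h j := by
  have hU : ⋃ j : ℕ, Set.Ico (j : ℝ) (j + 1) = Set.Ici 0 := by
    ext u
    simp only [Set.mem_iUnion, Set.mem_Ico, Set.mem_Ici]
    exact ⟨fun ⟨j, hj, _⟩ => j.cast_nonneg.trans hj,
      fun hu => ⟨⌊u⌋₊, Nat.floor_le hu, Nat.lt_floor_add_one u⟩⟩
  have hdisj : Pairwise (Function.onFun Disjoint fun j : ℕ => Set.Ico (j : ℝ) (j + 1)) := by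
    intro i j hij
    refine Set.disjoint_left.2 fun u hu hu' => hij ?_
    rw [← Nat.floor_eq_on_Ico i u hu, ← Nat.floor_eq_on_Ico j u hu']
  have hs := hasSum_integral_iUnion (fun j : ℕ => measurableSet_Ico) hdisj
    (f := fun u : ℝ => h ⌊u⌋₊) (μ := volume)
    (by rw [hU]; exact (integrable_indicator_iff measurableSet_Ici).1 hi)
  rw [integral_indicator measurableSet_Ici, ← hU, ← hs.tsum_eq]
  refine tsum_congr fun j => ?_
  rw [setIntegral_congr_fun (g := fun _ => h j) measurableSet_Ico fun u hu => by
    simp only [Nat.floor_eq_on_Ico j u hu]]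
  simp

open MeasureTheory in
lemma integral_indicator_floor_add_mul (h : ℕ → ℂ) (a : ℝ) {s : ℝ} (hs : 0 < s)
    (hi : Integrable fun t : ℝ => (Set.Ici (0 : ℝ)).indicator (fun u => h ⌊u⌋₊) (a + t * s)) :
    ∫ t : ℝ, (Set.Ici (0 : ℝ)).indicator (fun u => h ⌊u⌋₊) (a + t * s) =
      (s : ℂ)⁻¹ * ∑' j, h j := by
  set H := (Set.Ici (0 : ℝ)).indicator fun u => h ⌊u⌋₊ with hH
  have hi' : Integrable H := by
    have h1 : Integrable fun t : ℝ => H (a + t) :=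
      (integrable_comp_mul_right_iff (fun t => H (a + t)) hs.ne').1 hi
    simpa using h1.comp_add_left (-a)
  rw [← integral_indicator_floor h hi', Measure.integral_comp_mul_right (fun t => H (a + t)),
    integral_add_left_eq_self, abs_of_pos (inv_pos.2 hs)]
  simp [hH]

open MeasureTheory in
lemma integrable_exp_neg_abs : Integrable fun t : ℝ => Real.exp (-|t|) := by
  have h1 : IntegrableOn (fun t : ℝ => Real.exp (-|t|)) (Set.Ioi 0) :=
    (integrableOn_exp_neg_Ioi 0).congr_fun (fun t ht => by
      simp [abs_of_pos (Set.mem_Ioi.1 ht)]) measurableSet_Ioi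
  have h2 : IntegrableOn (fun t : ℝ => Real.exp (-|t|)) (Set.Iic 0) :=
    (integrableOn_exp_Iic 0).congr_fun (fun t ht => by
      simp [abs_of_nonpos (Set.mem_Iic.1 ht)]) measurableSet_Iic
  rw [← integrableOn_univ, ← Set.Iic_union_Ioi (a := (0 : ℝ))]
  exact h2.union h1

/-- The point `1 + (2/(ρn))^{1/2} ζ`. -/
noncomputable def scaledPoint (ρ : ℝ) (n : ℕ) (ζ : ℂ) : ℂ :=
  1 + (Real.sqrt (2 / (ρ * n)) : ℂ) * ζ

/-- The term of index `j` in the series of `E_{1/ρ}(R_n z)/z^n` at `z = 1 + (2/(ρn))^{1/2} ζ`,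
divided by the term of index `n` at `z = 1`. -/
noncomputable def scaledTerm (ρ : ℝ) (n : ℕ) (ζ : ℂ) (j : ℕ) : ℂ :=
  (Real.exp (logTerm ρ n j) : ℂ) * (scaledPoint ρ n ζ ^ j / scaledPoint ρ n ζ ^ n)

lemma sqrt_two_div_mul {ρ : ℝ} (hρ : 0 < ρ) (n : ℕ) :
    √(2 / (ρ * n)) = √(2 / ρ) / √(n : ℝ) := by
  rw [← Real.sqrt_div (by positivity), div_div]

lemma scaledTerm_eq_exp {ρ : ℝ} {n : ℕ} {ζ : ℂ} (hz : scaledPoint ρ n ζ ≠ 0) (j : ℕ) :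
    scaledTerm ρ n ζ j =
      Complex.exp (logTerm ρ n j + ((j : ℝ) - (n : ℝ) : ℝ) * Complex.log (scaledPoint ρ n ζ)) := by
  rw [Complex.exp_add, scaledTerm, Complex.ofReal_exp]
  congr 1
  push_cast
  rw [sub_mul, Complex.exp_sub, Complex.exp_nat_mul, Complex.exp_nat_mul, Complex.exp_log hz]

lemma tendsto_scaledPoint_sub_one {ρ : ℝ} (hρ : 0 < ρ) (ζ₀ : ℂ) :
    Tendsto (fun q : ℕ × ℂ => (√(2 / (ρ * q.1)) : ℂ) * q.2) (atTop ×ˢ 𝓝 ζ₀) (𝓝 0) := by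
  have h1 : Tendsto (fun n : ℕ => √(2 / (ρ * n))) atTop (𝓝 0) := by
    simp_rw [sqrt_two_div_mul hρ]
    exact tendsto_const_nhds.div_atTop tendsto_sqrt_natCast_atTop
  have h2 : Tendsto (fun n : ℕ => (√(2 / (ρ * n)) : ℂ)) atTop (𝓝 0) := by
    exact_mod_cast (Complex.continuous_ofReal.tendsto 0).comp h1
  simpa using (h2.comp tendsto_fst).mul (tendsto_snd (f := atTop (α := ℕ)) (g := 𝓝 ζ₀))

lemma one_add_ne_zero_of_norm_le_half {w : ℂ} (hw : ‖w‖ ≤ 1 / 2) : 1 + w ≠ 0 := by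
  intro h
  have : w = -1 := by linear_combination h
  rw [this] at hw
  norm_num at hw

lemma tendsto_scaledTerm_nearIndex {ρ : ℝ} (hρ : 1 < ρ) (ζ₀ : ℂ) (t : ℝ) :
    Tendsto (fun q : ℕ × ℂ => scaledTerm ρ q.1 q.2 (nearIndex q.1 t)) (atTop ×ˢ 𝓝 ζ₀)
      (𝓝 (Complex.exp (-(1 / (2 * ρ) : ℝ) * (t : ℂ) ^ 2 + √(2 / ρ) * ζ₀ * t + 0))) := by
  have hρ0 : 0 < ρ := by linarith
  set l : Filter (ℕ × ℂ) := atTop ×ˢ 𝓝 ζ₀ with hl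
  have hfst : Tendsto (Prod.fst : ℕ × ℂ → ℕ) l atTop := tendsto_fst
  have hsnd : Tendsto (Prod.snd : ℕ × ℂ → ℂ) l (𝓝 ζ₀) := tendsto_snd
  have hw := tendsto_scaledPoint_sub_one hρ0 ζ₀
  have hw2 : ∀ᶠ q in l, ‖(√(2 / (ρ * q.1)) : ℂ) * q.2‖ < 1 / 2 := by
    have := hw.norm
    rw [norm_zero] at this
    exact this.eventually_lt_const (by norm_num)
  let u : ℕ × ℂ → ℝ := fun q => ((nearIndex q.1 t : ℝ) - q.1) / √(q.1 : ℝ)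
  have hu : Tendsto u l (𝓝 t) := (tendsto_nearIndex t).comp hfst
  have huC : Tendsto (fun q => (u q : ℂ)) l (𝓝 t) := (Complex.continuous_ofReal.tendsto t).comp hu
  have hL : Tendsto (fun q : ℕ × ℂ => (logTerm ρ q.1 (nearIndex q.1 t) : ℂ)) l
      (𝓝 ((-t ^ 2 / (2 * ρ) : ℝ) : ℂ)) :=
    (Complex.continuous_ofReal.tendsto _).comp ((tendsto_logTerm_nearIndex hρ t).comp hfst)
  have hlin : Tendsto (fun q : ℕ × ℂ => (u q : ℂ) * (√(2 / ρ) * q.2)) l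
      (𝓝 (t * (√(2 / ρ) * ζ₀))) := huC.mul (hsnd.const_mul _)
  have hs : ∀ᶠ q in l, 0 < √(q.1 : ℝ) :=
    hfst.eventually (tendsto_sqrt_natCast_atTop.eventually_gt_atTop 0)
  have key : ∀ q : ℕ × ℂ, 0 < √(q.1 : ℝ) → ∀ v : ℂ,
      (((nearIndex q.1 t : ℝ) - (q.1 : ℝ) : ℝ) : ℂ) * ((√(2 / (ρ * q.1)) : ℂ) * v) =
        (u q : ℂ) * (√(2 / ρ) * v) := by
    intro q hq v
    have h0 : (√(q.1 : ℝ) : ℂ) ≠ 0 := by exact_mod_cast hq.ne'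
    simp only [u]
    rw [sqrt_two_div_mul hρ0]
    push_cast
    field_simp
  have herr : Tendsto (fun q : ℕ × ℂ => (((nearIndex q.1 t : ℝ) - (q.1 : ℝ) : ℝ) : ℂ) *
      (Complex.log (scaledPoint ρ q.1 q.2) - (√(2 / (ρ * q.1)) : ℂ) * q.2)) l (𝓝 0) := by
    have hb : Tendsto (fun q : ℕ × ℂ => ‖(u q : ℂ) * (√(2 / ρ) * q.2)‖ *
        ‖(√(2 / (ρ * q.1)) : ℂ) * q.2‖) l (𝓝 0) := by
      simpa using hlin.norm.mul hw.norm
    refine squeeze_zero_norm' ?_ hb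
    filter_upwards [hw2, hs] with q hq hsq
    rw [← key q hsq q.2, norm_mul, norm_mul _ ((√(2 / (ρ * q.1)) : ℂ) * q.2), mul_assoc]
    gcongr
    refine (Complex.norm_log_one_add_sub_self_le (by linarith)).trans ?_
    have h2 : (1 - ‖(√(2 / (ρ * q.1)) : ℂ) * q.2‖)⁻¹ ≤ 2 :=
      inv_le_of_inv_le₀ (by norm_num) (by linarith)
    nlinarith [sq_nonneg ‖(√(2 / (ρ * q.1)) : ℂ) * q.2‖]
  have hsum := (hL.add (hlin.add herr)).cexp
  have hlim : ((-t ^ 2 / (2 * ρ) : ℝ) : ℂ) + (t * (√(2 / ρ) * ζ₀) + 0) =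
      -(1 / (2 * ρ) : ℝ) * (t : ℂ) ^ 2 + √(2 / ρ) * ζ₀ * t + 0 := by
    push_cast
    ring
  rw [hlim] at hsum
  refine hsum.congr' ?_
  filter_upwards [hw2, hs] with q hq hsq
  rw [scaledTerm_eq_exp (one_add_ne_zero_of_norm_le_half hq.le), ← key q hsq q.2]
  congr 1
  ring

lemma norm_scaledTerm_le {ρ B D : ℝ} {n j : ℕ} {ζ : ℂ}
    (hw : ‖(√(2 / (ρ * n)) : ℂ) * ζ‖ ≤ 1 / 2)
    (hB : 3 / 2 * ‖(√(2 / (ρ * n)) : ℂ) * ζ‖ ≤ B / √(n : ℝ))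
    (hD : logTerm ρ n j ≤ D - (B + 1) * (|(j : ℝ) - n| / √(n : ℝ))) :
    ‖scaledTerm ρ n ζ j‖ ≤ Real.exp (D - |(j : ℝ) - n| / √(n : ℝ)) := by
  rw [scaledTerm_eq_exp (one_add_ne_zero_of_norm_le_half hw), Complex.exp_add, norm_mul,
    ← Complex.ofReal_exp, Complex.norm_real, Real.norm_of_nonneg (Real.exp_pos _).le]
  have h1 : ‖Complex.log (scaledPoint ρ n ζ)‖ ≤ B / √(n : ℝ) :=
    (Complex.norm_log_one_add_half_le_self hw).trans hB
  have h2 : ‖(((j : ℝ) - (n : ℝ) : ℝ) : ℂ) * Complex.log (scaledPoint ρ n ζ)‖ ≤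
      |(j : ℝ) - n| * (B / √(n : ℝ)) := by
    rw [norm_mul, Complex.norm_real, Real.norm_eq_abs]
    gcongr
  calc _ ≤ Real.exp (D - (B + 1) * (|(j : ℝ) - n| / √(n : ℝ))) *
        Real.exp (|(j : ℝ) - n| * (B / √(n : ℝ))) := by
        gcongr
        exact (Complex.norm_exp_le_exp_norm _).trans (Real.exp_le_exp.2 h2)
    _ = _ := by
        rw [← Real.exp_add]
        congr 1
        ring

lemma sub_one_le_abs_nearIndex_sub_div {n : ℕ} {t : ℝ} (hn : 1 ≤ √(n : ℝ))
    (h : 0 ≤ (n : ℝ) + t * √(n : ℝ)) :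
    |t| - 1 ≤ |(nearIndex n t : ℝ) - n| / √(n : ℝ) := by
  rw [le_div_iff₀ (by linarith), sub_mul, one_mul]
  have h1 := abs_nearIndex_sub_le h
  have h2 : |t| * √(n : ℝ) = |t * √(n : ℝ)| := by
    rw [abs_mul, abs_of_nonneg (Real.sqrt_nonneg _)]
  have h3 := abs_sub_abs_le_abs_sub (t * √(n : ℝ)) ((nearIndex n t : ℝ) - n)
  rw [abs_sub_comm (t * √(n : ℝ))] at h3
  rw [h2]
  linarith

open MeasureTheory in
lemma tendsto_inv_sqrt_mul_tsum_scaledTerm {ρ : ℝ} (hρ : 1 < ρ) (ζ₀ : ℂ) :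
    Tendsto (fun q : ℕ × ℂ => (√(q.1 : ℝ) : ℂ)⁻¹ * ∑' j, scaledTerm ρ q.1 q.2 j) (atTop ×ˢ 𝓝 ζ₀)
      (𝓝 ((π / (1 / (2 * ρ) : ℝ)) ^ (1 / 2 : ℂ) * Complex.exp (ζ₀ ^ 2))) := by
  have hρ0 : 0 < ρ := by linarith
  set l : Filter (ℕ × ℂ) := atTop ×ˢ 𝓝 ζ₀ with hl
  have hfst : Tendsto (Prod.fst : ℕ × ℂ → ℕ) l atTop := tendsto_fst
  have hsnd : Tendsto (Prod.snd : ℕ × ℂ → ℂ) l (𝓝 ζ₀) := tendsto_snd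
  set B := 3 / 2 * (√(2 / ρ) * (‖ζ₀‖ + 1)) with hB
  have hB0 : 0 ≤ B := by positivity
  obtain ⟨D, hD⟩ := exists_logTerm_le (c := B + 1) hρ (by positivity)
  let F : ℕ × ℂ → ℝ → ℂ := fun q t =>
    (Set.Ici (0 : ℝ)).indicator (fun u => scaledTerm ρ q.1 q.2 ⌊u⌋₊) (q.1 + t * √(q.1 : ℝ))
  have hFmeas (q : ℕ × ℂ) : AEStronglyMeasurable (F q) volume := by
    have h1 : Measurable ((Set.Ici (0 : ℝ)).indicator fun u => scaledTerm ρ q.1 q.2 ⌊u⌋₊) :=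
      ((measurable_from_nat (f := scaledTerm ρ q.1 q.2)).comp
        Nat.measurable_floor).indicator measurableSet_Ici
    exact (h1.comp (by fun_prop)).aestronglyMeasurable
  have hbound : Integrable fun t : ℝ => Real.exp (D + 1) * Real.exp (-|t|) :=
    integrable_exp_neg_abs.const_mul _
  have hw := tendsto_scaledPoint_sub_one hρ0 ζ₀
  have hFle : ∀ᶠ q in l, ∀ t, ‖F q t‖ ≤ Real.exp (D + 1) * Real.exp (-|t|) := by
    have hw2 : ∀ᶠ q in l, ‖(√(2 / (ρ * q.1)) : ℂ) * q.2‖ < 1 / 2 := by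
      have := hw.norm
      rw [norm_zero] at this
      exact this.eventually_lt_const (by norm_num)
    filter_upwards [hw2, hfst.eventually hD,
      hfst.eventually (tendsto_sqrt_natCast_atTop.eventually_ge_atTop 1),
      hsnd.norm.eventually_lt_const (by linarith : ‖ζ₀‖ < ‖ζ₀‖ + 1)] with q hq hqD hs hζ t
    by_cases h0 : 0 ≤ (q.1 : ℝ) + t * √(q.1 : ℝ)
    · have hBq : 3 / 2 * ‖(√(2 / (ρ * q.1)) : ℂ) * q.2‖ ≤ B / √(q.1 : ℝ) := by
        rw [norm_mul, Complex.norm_real, Real.norm_of_nonneg (Real.sqrt_nonneg _),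
          sqrt_two_div_mul hρ0, hB, mul_div_assoc, mul_div_right_comm]
        gcongr
      have hF : F q t = scaledTerm ρ q.1 q.2 (nearIndex q.1 t) :=
        Set.indicator_of_mem (Set.mem_Ici.2 h0) _
      rw [hF]
      refine (norm_scaledTerm_le hq.le hBq (hqD _)).trans ?_
      rw [← Real.exp_add]
      refine Real.exp_le_exp.2 ?_
      linarith [sub_one_le_abs_nearIndex_sub_div hs h0]
    · have hF : F q t = 0 := Set.indicator_of_notMem (by simpa using h0) _
      rw [hF, norm_zero]
      positivity
  have hFlim (t : ℝ) : Tendsto (fun q => F q t) l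
      (𝓝 (Complex.exp (-(1 / (2 * ρ) : ℝ) * (t : ℂ) ^ 2 + √(2 / ρ) * ζ₀ * t + 0))) := by
    refine (tendsto_scaledTerm_nearIndex hρ ζ₀ t).congr' ?_
    filter_upwards [hfst.eventually (eventually_natCast_add_mul_sqrt_nonneg t)] with q hq
    exact (Set.indicator_of_mem (Set.mem_Ici.2 hq)
      (fun u : ℝ => scaledTerm ρ q.1 q.2 ⌊u⌋₊)).symm
  have hmain := tendsto_integral_filter_of_dominated_convergence _
    (Eventually.of_forall hFmeas) (hFle.mono fun q hq => ae_of_all _ hq) hbound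
    (ae_of_all _ hFlim)
  have hb : (-((1 / (2 * ρ) : ℝ) : ℂ)).re < 0 := by
    rw [Complex.neg_re, Complex.ofReal_re, neg_lt_zero]
    positivity
  rw [integral_cexp_quadratic hb, neg_neg] at hmain
  have hexp : (0 : ℂ) - (√(2 / ρ) * ζ₀) ^ 2 / (4 * -((1 / (2 * ρ) : ℝ) : ℂ)) = ζ₀ ^ 2 := by
    have h1 : ((√(2 / ρ) : ℝ) : ℂ) ^ 2 = 2 / ρ := by
      rw [← Complex.ofReal_pow, Real.sq_sqrt (by positivity)]
      push_cast
      rfl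
    have h2 : (ρ : ℂ) ≠ 0 := by exact_mod_cast hρ0.ne'
    rw [mul_pow, h1]
    push_cast
    field_simp
    ring
  rw [hexp] at hmain
  refine hmain.congr' ?_
  filter_upwards [hFle, hfst.eventually (tendsto_sqrt_natCast_atTop.eventually_gt_atTop 0)]
    with q hq hs
  exact integral_indicator_floor_add_mul _ _ hs
    (hbound.mono' (hFmeas q) (ae_of_all _ hq))

lemma tsum_scaledTerm {ρ : ℝ} (hρ : 1 < ρ) (n : ℕ) (ζ : ℂ) :
    ∑' j, scaledTerm ρ n ζ j = (Real.Gamma (1 + n / ρ) / Rn ρ n ^ n : ℝ) *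
      (mlE ρ (Rn ρ n * scaledPoint ρ n ζ) / scaledPoint ρ n ζ ^ n) := by
  have hR := Rn_pos hρ n
  have hG (j : ℕ) : 0 < Real.Gamma (1 + j / ρ) :=
    Real.Gamma_pos_of_pos (one_add_div_pos hρ (by linarith [(j.cast_nonneg : (0 : ℝ) ≤ j)]))
  have hexp (j : ℕ) : Real.exp (logTerm ρ n j) =
      Real.Gamma (1 + n / ρ) / Rn ρ n ^ n * (Rn ρ n ^ j / Real.Gamma (1 + j / ρ)) := by
    unfold logTerm logGammaScaled
    rw [Real.exp_sub, Real.exp_add, sub_mul, Real.exp_sub, Real.exp_nat_mul, Real.exp_nat_mul,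
      Real.exp_log hR, Real.exp_log (hG n), Real.exp_log (hG j)]
    ring
  rw [mlE, ← tsum_div_const, ← tsum_mul_left]
  refine tsum_congr fun j => ?_
  rw [scaledTerm, hexp]
  push_cast
  ring

theorem stmt18 (ρ : ℝ) (hρ : 1 < ρ) (K : Set ℂ) (hK : IsCompact K) :
    TendstoUniformlyOn
      (fun (n : ℕ) (ζ : ℂ) =>
        mlE ρ ((Rn ρ n : ℂ) * (1 + (Real.sqrt (2 / (ρ * n)) : ℂ) * ζ)) /
          ((1 + (Real.sqrt (2 / (ρ * n)) : ℂ) * ζ) ^ n * mlE ρ ((Rn ρ n : ℂ))))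
      (fun ζ => Complex.exp (ζ ^ 2)) atTop K := by

  have hρ0 : 0 < ρ := by linarith
  rw [← tendstoLocallyUniformlyOn_iff_tendstoUniformlyOn_of_compact hK,
    tendstoLocallyUniformlyOn_iff_filter]
  intro ζ₀ _
  set A : ℂ := (π / (1 / (2 * ρ) : ℝ)) ^ (1 / 2 : ℂ) with hA
  have hA0 : A ≠ 0 := by
    rw [hA, Complex.cpow_ne_zero_iff]
    left
    have : π / (1 / (2 * ρ)) ≠ 0 := by positivity
    exact_mod_cast this
  have hnum := (tendsto_inv_sqrt_mul_tsum_scaledTerm hρ ζ₀).mono_left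
    (Filter.prod_mono_right atTop (nhdsWithin_le_nhds (s := K)))
  have hden : Tendsto (fun q : ℕ × ℂ => (√(q.1 : ℝ) : ℂ)⁻¹ * ∑' j, scaledTerm ρ q.1 0 j)
      (atTop ×ˢ 𝓝[K] ζ₀) (𝓝 A) := by
    have h := (tendsto_inv_sqrt_mul_tsum_scaledTerm hρ 0).comp
      ((tendsto_id (α := ℕ) (x := atTop)).prodMk (tendsto_const_nhds (x := (0 : ℂ))))
    rw [zero_pow two_ne_zero, Complex.exp_zero, mul_one] at h
    exact h.comp tendsto_fst
  have hquot := hnum.div hden hA0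
  rw [mul_div_cancel_left₀ _ hA0] at hquot
  have hlim : Tendsto (fun q : ℕ × ℂ => Complex.exp (q.2 ^ 2)) (atTop ×ˢ 𝓝[K] ζ₀)
      (𝓝 (Complex.exp (ζ₀ ^ 2))) := by
    have hc : Continuous fun ζ : ℂ => Complex.exp (ζ ^ 2) := by fun_prop
    exact (hc.tendsto ζ₀).comp (tendsto_snd.mono_right nhdsWithin_le_nhds)
  rw [tendstoUniformlyOnFilter_iff_tendsto]
  refine Tendsto.mono_right ?_ (nhds_le_uniformity (Complex.exp (ζ₀ ^ 2)))
  rw [nhds_prod_eq]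
  refine hlim.prodMk (hquot.congr' ?_)
  filter_upwards [tendsto_fst.eventually (eventually_gt_atTop (0 : ℕ))] with q hq
  have hs : (√(q.1 : ℝ) : ℂ) ≠ 0 := by
    have : √(q.1 : ℝ) ≠ 0 := by positivity
    exact_mod_cast this
  have hC : ((Real.Gamma (1 + q.1 / ρ) / Rn ρ q.1 ^ q.1 : ℝ) : ℂ) ≠ 0 := by
    have hn : (0 : ℝ) ≤ q.1 := q.1.cast_nonneg
    exact_mod_cast (div_pos (Real.Gamma_pos_of_pos (one_add_div_pos hρ (by linarith)))
      (pow_pos (Rn_pos hρ q.1) _)).ne'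
  have h0 : scaledPoint ρ q.1 0 = 1 := by simp [scaledPoint]
  change (√(q.1 : ℝ) : ℂ)⁻¹ * _ / ((√(q.1 : ℝ) : ℂ)⁻¹ * _) = _
  rw [mul_div_mul_left _ _ (inv_ne_zero hs), tsum_scaledTerm hρ, tsum_scaledTerm hρ,
    mul_div_mul_left _ _ hC, h0, one_pow, div_one, mul_one, div_div]
  rfl
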